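/- Let V be a finite collection of finite-valued random variables forming a Bayesian hypergraph satisfying hypergraph faithfulness and hypergraph collider amplification, equipped with a bivariate partial information decomposition whose atoms are nonnegative and satisfy the consistency equations, and suppose persistent relevance holds. Then every directed hyperedge ε with tail T(ε) and head H(ε) exhibits the following PID signatures: (i) for every X_i ∈ T(ε), X_j ∈ H(ε), and X_k ∈ T(ε) \ {X_i}, the bivariate PID with sources X_j, X_k has positive synergy about X_i: Syn(X_j, X_k; X_i) > 0; (ii) for every X_i ∈ T(ε) and X_j ∈ H(ε), the head variable has positive unique information about the tail variable: Uniq^{V'}(X_j; X_i) > 0; (iii) for every pair of distinct co-heads X_j, X_k ∈ H(ε), Uniq^{V'}(X_j; X_k) > 0 and Uniq^{V'}(X_k; X_j) > 0. -/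

import Mathlib

open scoped BigOperators

/-- A probability mass function on a finite outcome space `Ω`. -/
structure FinProb (Ω : Type*) [Fintype Ω] where
  p : Ω → ℝ
  nonneg : ∀ ω, 0 ≤ p ω
  sum_one : ∑ ω, p ω = 1

/-- The probability that the finite-valued random variable `X` takes the value `a`. -/
def prob {Ω : Type*} [Fintype Ω] {α : Type*} [DecidableEq α]
    (μ : FinProb Ω) (X : Ω → α) (a : α) : ℝ :=
  ∑ ω, if X ω = a then μ.p ω else 0

/-- Shannon mutual information `I(X ; Y)` of two finite-valued random variables
(natural logarithm; the convention `0 · log 0 = 0` holds since `Real.log 0 = 0`). -/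
noncomputable def MI {Ω : Type*} [Fintype Ω] {α β : Type*}
    [Fintype α] [DecidableEq α] [Fintype β] [DecidableEq β]
    (μ : FinProb Ω) (X : Ω → α) (Y : Ω → β) : ℝ :=
  ∑ a : α, ∑ b : β,
    prob μ (fun ω => (X ω, Y ω)) (a, b) *
      Real.log (prob μ (fun ω => (X ω, Y ω)) (a, b) /
        (prob μ X a * prob μ Y b))

/-- Conditional mutual information `I(X ; Y ∣ Z)` of finite-valued random variables. -/
noncomputable def condMI {Ω : Type*} [Fintype Ω] {α β γ : Type*}
    [Fintype α] [DecidableEq α] [Fintype β] [DecidableEq β] [Fintype γ] [DecidableEq γ]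
    (μ : FinProb Ω) (X : Ω → α) (Y : Ω → β) (Z : Ω → γ) : ℝ :=
  ∑ a : α, ∑ b : β, ∑ c : γ,
    prob μ (fun ω => (X ω, Y ω, Z ω)) (a, b, c) *
      Real.log ((prob μ Z c * prob μ (fun ω => (X ω, Y ω, Z ω)) (a, b, c)) /
        (prob μ (fun ω => (X ω, Z ω)) (a, c) * prob μ (fun ω => (Y ω, Z ω)) (b, c)))

/-- The joint random variable (supervariable) of the subfamily of `X` indexed by `s`. -/
def jointRV {Ω V α : Type*} [DecidableEq V]
    (X : V → Ω → α) (s : Finset V) : Ω → (V → Option α) :=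
  fun ω i => if i ∈ s then some (X i ω) else none

/-- A bivariate partial information decomposition (PID) attached to the family `X`:
for each pair of source index sets `A, B` and target `t` it provides nonnegative atoms
`Red A B t = Red(X_A, X_B ; X_t)`, `Uniq A B t = Uniq(X_A ; X_t ∣ X_B)` and
`Syn A B t = Syn(X_A, X_B ; X_t)` satisfying the consistency equations. -/
structure BivPID {Ω V α : Type*} [Fintype Ω] [Fintype V] [DecidableEq V]
    [Fintype α] [DecidableEq α] (μ : FinProb Ω) (X : V → Ω → α) where
  Red : Finset V → Finset V → V → ℝ
  Uniq : Finset V → Finset V → V → ℝ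
  Syn : Finset V → Finset V → V → ℝ
  red_nonneg : ∀ A B t, 0 ≤ Red A B t
  uniq_nonneg : ∀ A B t, 0 ≤ Uniq A B t
  syn_nonneg : ∀ A B t, 0 ≤ Syn A B t
  consistency_fst : ∀ A B t, MI μ (jointRV X A) (X t) = Red A B t + Uniq A B t
  consistency_snd : ∀ A B t, MI μ (jointRV X B) (X t) = Red A B t + Uniq B A t
  consistency_joint : ∀ A B t,
    MI μ (jointRV X (A ∪ B)) (X t) =
      Red A B t + Uniq A B t + Uniq B A t + Syn A B t

variable {Ω V α : Type*} [Fintype Ω] [Fintype V] [DecidableEq V] [Fintype α] [DecidableEq α]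

/-- Monotonicity of unique information: augmenting the other source with further
variables cannot increase the unique information of a source. -/
def BivPID.UniqMono {μ : FinProb Ω} {X : V → Ω → α} (P : BivPID μ X) : Prop :=
  ∀ A B K t, P.Uniq A (B ∪ K) t ≤ P.Uniq A B t

/-- Information monotonicity: augmenting a source with further variables cannot
decrease the synergy atom containing it. -/
def BivPID.SynMono {μ : FinProb Ω} {X : V → Ω → α} (P : BivPID μ X) : Prop :=
  ∀ A B K t, P.Syn A B t ≤ P.Syn (A ∪ K) B t

/-- `Uniq^{V'}(X_j ; X_i)` : unique information of `X_j` about the target `X_i`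
relative to the supervariable of all the remaining variables. -/
def BivPID.uniqC {μ : FinProb Ω} {X : V → Ω → α} (P : BivPID μ X) (j i : V) : ℝ :=
  P.Uniq {j} (Finset.univ \ {i, j}) i

/-- Persistent relevance: a variable whose conditional mutual information with the
target is positive for every conditioning set has positive unique information. -/
def BivPID.PersistentRelevance {μ : FinProb Ω} {X : V → Ω → α} (P : BivPID μ X) : Prop :=
  ∀ i t : V, i ≠ t →
    (∀ C : Finset V, C ⊆ Finset.univ \ {i, t} →
      0 < condMI μ (X i) (X t) (jointRV X C)) →
    0 < P.uniqC i t

/-- `j` is a parent of `i` in the directed hypergraph `E`. -/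
def IsHParent {V : Type*} (E : Finset (Finset V × Finset V)) (j i : V) : Prop :=
  ∃ ε ∈ E, j ∈ ε.1 ∧ i ∈ ε.2

/-- `j` is a child of `i` in the directed hypergraph `E`. -/
def IsHChild {V : Type*} (E : Finset (Finset V × Finset V)) (j i : V) : Prop :=
  ∃ ε ∈ E, j ∈ ε.2 ∧ i ∈ ε.1

/-- `j` and `i` are co-heads: some hyperedge contains both in its head. -/
def IsHCoHead {V : Type*} (E : Finset (Finset V × Finset V)) (j i : V) : Prop :=
  j ≠ i ∧ ∃ ε ∈ E, j ∈ ε.2 ∧ i ∈ ε.2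

/-- `j` and `i` are co-tails: some hyperedge contains both in its tail. -/
def IsHCoTail {V : Type*} (E : Finset (Finset V × Finset V)) (j i : V) : Prop :=
  j ≠ i ∧ ∃ ε ∈ E, j ∈ ε.1 ∧ i ∈ ε.1

/-- A step of a partially directed cycle: from a vertex to a vertex it is a parent
of, or to a distinct co-head. -/
def PDStep {V : Type*} (E : Finset (Finset V × Finset V)) (u v : V) : Prop :=
  (∃ ε ∈ E, u ∈ ε.1 ∧ v ∈ ε.2) ∨ (u ≠ v ∧ ∃ ε ∈ E, u ∈ ε.2 ∧ v ∈ ε.2)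

/-- The directed hypergraph has no partially directed cycles (cyclic sequences of
parent/co-head steps containing at least one genuinely directed step). -/
def HAcyclic {V : Type*} (E : Finset (Finset V × Finset V)) : Prop :=
  ¬ ∃ (f : ℕ → V) (k : ℕ), 0 < k ∧ f k = f 0 ∧
      (∀ i < k, PDStep E (f i) (f (i + 1))) ∧
      ∃ i < k, ∃ ε ∈ E, f i ∈ ε.1 ∧ f (i + 1) ∈ ε.2

open scoped Classical

/-- A single co-head step. -/
def CoHeadStep {V : Type*} (E : Finset (Finset V × Finset V)) (u v : V) : Prop :=
  ∃ ε ∈ E, u ∈ ε.2 ∧ v ∈ ε.2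

/-- `u` and `v` lie in the same chain component: they are joined by a chain of
co-head steps. -/
def SameChain {V : Type*} (E : Finset (Finset V × Finset V)) (u v : V) : Prop :=
  Relation.ReflTransGen (CoHeadStep E) u v

/-- The chain component of `v`. -/
noncomputable def chainComp {V : Type*} [Fintype V]
    (E : Finset (Finset V × Finset V)) (v : V) : Finset V :=
  Finset.univ.filter (fun u => SameChain E v u)

/-- The set of all chain components. -/
noncomputable def chainComps {V : Type*} [Fintype V] [DecidableEq V]
    (E : Finset (Finset V × Finset V)) : Finset (Finset V) :=
  Finset.univ.image (chainComp E)

/-- The variables in the parent chain components of `τ` (in the canonical DAG). -/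
noncomputable def paVars {V : Type*} [Fintype V]
    (E : Finset (Finset V × Finset V)) (τ : Finset V) : Finset V :=
  Finset.univ.filter (fun w => w ∉ τ ∧
    ∃ u, SameChain E u w ∧ ∃ ε ∈ E, u ∈ ε.1 ∧ ∃ h ∈ ε.2, h ∈ τ)

/-- Containment of hyperedges. -/
def EdgeContained {V : Type*} [DecidableEq V] (ε₁ ε₂ : Finset V × Finset V) : Prop :=
  ε₁.1 ∪ ε₁.2 ⊂ ε₂.1 ∪ ε₂.2

/-- An irreducible hyperedge: one not contained in any other hyperedge. -/
def IrredEdge {V : Type*} [DecidableEq V] (E : Finset (Finset V × Finset V))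
    (ε : Finset V × Finset V) : Prop :=
  ε ∈ E ∧ ∀ ε' ∈ E, ¬ EdgeContained ε ε'

/-- The irreducible hyperedges whose head meets the chain component `τ`. -/
noncomputable def edgesInto {V : Type*} [Fintype V] [DecidableEq V]
    (E : Finset (Finset V × Finset V)) (τ : Finset V) :
    Finset (Finset V × Finset V) :=
  E.filter (fun ε => (∃ h ∈ ε.2, h ∈ τ) ∧ IrredEdge E ε)

/-- The joint pmf factorizes over chain components as `∏ τ P(X_τ ∣ X_{pa(τ)})`, each
conditional being proportional to a product of nonnegative potentials over the
irreducible hyperedges of the component. -/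
def HFactorizes {Ω V α : Type*} [Fintype Ω] [Fintype V] [DecidableEq V]
    [Fintype α] [DecidableEq α]
    (μ : FinProb Ω) (X : V → Ω → α) (E : Finset (Finset V × Finset V)) : Prop :=
  ∃ (ψ : Finset V × Finset V → (V → α) → ℝ) (g : Finset V → (V → α) → ℝ),
    (∀ ε x, 0 ≤ ψ ε x) ∧
    (∀ ε ∈ E, ∀ x y : V → α, (∀ v ∈ ε.1 ∪ ε.2, x v = y v) → ψ ε x = ψ ε y) ∧
    (∀ τ x, 0 ≤ g τ x) ∧
    (∀ τ ∈ chainComps E, ∀ x y : V → α,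
      (∀ v ∈ τ ∪ paVars E τ, x v = y v) → g τ x = g τ y) ∧
    (∀ τ ∈ chainComps E, ∀ x : V → α,
      ∑ y : {v // v ∈ τ} → α,
        g τ (fun w => if h : w ∈ τ then y ⟨w, h⟩ else x w) = 1) ∧
    (∀ τ ∈ chainComps E, ∃ Z : (V → α) → ℝ,
      (∀ x y : V → α, (∀ v ∈ paVars E τ, x v = y v) → Z x = Z y) ∧
      ∀ x : V → α, Z x * g τ x = ∏ ε ∈ edgesInto E τ, ψ ε x) ∧
    (∀ x : V → α, prob μ (fun ω k => X k ω) x = ∏ τ ∈ chainComps E, g τ x)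

/-- Hypergraph faithfulness: parents, children and co-heads of `i` remain
conditionally dependent on `i` given any conditioning set, while any other
variable can be separated from `i` by some conditioning set. -/
def HFaithful {Ω V α : Type*} [Fintype Ω] [Fintype V] [DecidableEq V]
    [Fintype α] [DecidableEq α]
    (μ : FinProb Ω) (X : V → Ω → α) (E : Finset (Finset V × Finset V)) : Prop :=
  (∀ i j : V, j ≠ i →
    (IsHParent E j i ∨ IsHChild E j i ∨ IsHCoHead E j i) →
    ∀ C : Finset V, C ⊆ Finset.univ \ {i, j} →
      0 < condMI μ (X j) (X i) (jointRV X C)) ∧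
  (∀ i j : V, j ≠ i →
    ¬ (IsHParent E j i ∨ IsHChild E j i ∨ IsHCoHead E j i) →
    ∃ C : Finset V, C ⊆ Finset.univ \ {i, j} ∧
      condMI μ (X j) (X i) (jointRV X C) = 0)

/-- Hypergraph collider amplification: conditioning on a head variable strictly
increases the mutual information between any two distinct co-tails of the
same hyperedge. -/
def HColliderAmp {Ω V α : Type*} [Fintype Ω] [Fintype V] [DecidableEq V]
    [Fintype α] [DecidableEq α]
    (μ : FinProb Ω) (X : V → Ω → α) (E : Finset (Finset V × Finset V)) : Prop :=
  ∀ ε ∈ E, ∀ i ∈ ε.1, ∀ k ∈ ε.1, i ≠ k → ∀ j ∈ ε.2,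
    MI μ (X i) (X k) < condMI μ (X i) (X k) (X j)

/-- The probability of the value that `X` takes at `ω`. -/
noncomputable def valueProb {Ω A : Type*} [Fintype Ω] [DecidableEq A]
    (μ : FinProb Ω) (X : Ω → A) (ω : Ω) : ℝ :=
  prob μ X (X ω)

lemma valueProb_pos {Ω A : Type*} [Fintype Ω] [DecidableEq A]
    (μ : FinProb Ω) (X : Ω → A) {ω : Ω} (h : μ.p ω ≠ 0) : 0 < valueProb μ X ω := by
  have hω : 0 < μ.p ω := lt_of_le_of_ne (μ.nonneg ω) (Ne.symm h)
  refine Finset.sum_pos' (fun ω' _ => ?_) ⟨ω, Finset.mem_univ ω, by simpa using hω⟩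
  split_ifs
  · exact μ.nonneg ω'
  · exact le_rfl

/-- `valueProb` depends only on the partition of the outcome space induced by the variable. -/
lemma valueProb_congr {Ω A B : Type*} [Fintype Ω] [DecidableEq A] [DecidableEq B]
    (μ : FinProb Ω) (X : Ω → A) (Y : Ω → B)
    (h : ∀ ω ω', X ω = X ω' ↔ Y ω = Y ω') (ω : Ω) :
    valueProb μ X ω = valueProb μ Y ω := by
  simp only [valueProb, prob, h]

lemma sum_prob_mul {Ω A : Type*} [Fintype Ω] [Fintype A] [DecidableEq A]
    (μ : FinProb Ω) (X : Ω → A) (f : A → ℝ) :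
    ∑ a, prob μ X a * f a = ∑ ω, μ.p ω * f (X ω) := by
  simp only [prob, Finset.sum_mul, ite_mul, zero_mul]
  rw [Finset.sum_comm]
  simp

lemma MI_eq_expectation {Ω A B : Type*} [Fintype Ω] [Fintype A] [DecidableEq A]
    [Fintype B] [DecidableEq B] (μ : FinProb Ω) (X : Ω → A) (Y : Ω → B) :
    MI μ X Y = ∑ ω, μ.p ω * (Real.log (valueProb μ (fun ω => (X ω, Y ω)) ω) -
      Real.log (valueProb μ X ω) - Real.log (valueProb μ Y ω)) := by
  have h := sum_prob_mul μ (fun ω => (X ω, Y ω)) (fun c =>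
    Real.log (prob μ (fun ω => (X ω, Y ω)) c / (prob μ X c.1 * prob μ Y c.2)))
  rw [Fintype.sum_prod_type] at h
  refine h.trans (Finset.sum_congr rfl fun ω _ => ?_)
  by_cases hω : μ.p ω = 0
  · simp [hω]
  have hXY := (valueProb_pos μ (fun ω => (X ω, Y ω)) hω).ne'
  have hX := (valueProb_pos μ X hω).ne'
  have hY := (valueProb_pos μ Y hω).ne'
  simp only [valueProb] at hXY hX hY ⊢
  rw [Real.log_div hXY (mul_ne_zero hX hY), Real.log_mul hX hY]
  ring

lemma condMI_eq_expectation {Ω A B C : Type*} [Fintype Ω] [Fintype A] [DecidableEq A]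
    [Fintype B] [DecidableEq B] [Fintype C] [DecidableEq C]
    (μ : FinProb Ω) (X : Ω → A) (Y : Ω → B) (Z : Ω → C) :
    condMI μ X Y Z = ∑ ω, μ.p ω * (Real.log (valueProb μ Z ω) +
      Real.log (valueProb μ (fun ω => (X ω, Y ω, Z ω)) ω) -
      Real.log (valueProb μ (fun ω => (X ω, Z ω)) ω) -
      Real.log (valueProb μ (fun ω => (Y ω, Z ω)) ω)) := by
  have h := sum_prob_mul μ (fun ω => (X ω, Y ω, Z ω)) (fun c =>
    Real.log ((prob μ Z c.2.2 * prob μ (fun ω => (X ω, Y ω, Z ω)) c) /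
      (prob μ (fun ω => (X ω, Z ω)) (c.1, c.2.2) * prob μ (fun ω => (Y ω, Z ω)) c.2)))
  simp only [Fintype.sum_prod_type] at h
  refine h.trans (Finset.sum_congr rfl fun ω _ => ?_)
  by_cases hω : μ.p ω = 0
  · simp [hω]
  have hXYZ := (valueProb_pos μ (fun ω => (X ω, Y ω, Z ω)) hω).ne'
  have hXZ := (valueProb_pos μ (fun ω => (X ω, Z ω)) hω).ne'
  have hYZ := (valueProb_pos μ (fun ω => (Y ω, Z ω)) hω).ne'
  have hZ := (valueProb_pos μ Z hω).ne'
  simp only [valueProb] at hXYZ hXZ hYZ hZ ⊢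
  rw [Real.log_div (mul_ne_zero hZ hXYZ) (mul_ne_zero hXZ hYZ), Real.log_mul hZ hXYZ,
    Real.log_mul hXZ hYZ]
  ring

/-- Mutual information depends on its first argument only through the induced partition. -/
lemma MI_congr_left {Ω A A' B : Type*} [Fintype Ω] [Fintype A] [DecidableEq A]
    [Fintype A'] [DecidableEq A'] [Fintype B] [DecidableEq B]
    (μ : FinProb Ω) (X : Ω → A) (X' : Ω → A') (Y : Ω → B)
    (h : ∀ ω ω', X ω = X ω' ↔ X' ω = X' ω') : MI μ X Y = MI μ X' Y := by
  simp only [MI_eq_expectation, valueProb_congr μ X X' h,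
    valueProb_congr μ (fun ω => (X ω, Y ω)) (fun ω => (X' ω, Y ω))
      (fun ω ω' => by simp only [Prod.mk.injEq, h])]

lemma MI_comm {Ω A B : Type*} [Fintype Ω] [Fintype A] [DecidableEq A]
    [Fintype B] [DecidableEq B] (μ : FinProb Ω) (X : Ω → A) (Y : Ω → B) :
    MI μ X Y = MI μ Y X := by
  simp only [MI_eq_expectation, valueProb_congr μ (fun ω => (X ω, Y ω)) (fun ω => (Y ω, X ω))
    (fun ω ω' => by simp only [Prod.mk.injEq, and_comm])]
  exact Finset.sum_congr rfl fun ω _ => by ring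

/-- The chain rule `I(Z, Y ; X) = I(Z ; X) + I(X ; Y ∣ Z)`. -/
lemma MI_chain_rule {Ω A B C : Type*} [Fintype Ω] [Fintype A] [DecidableEq A]
    [Fintype B] [DecidableEq B] [Fintype C] [DecidableEq C]
    (μ : FinProb Ω) (X : Ω → A) (Y : Ω → B) (Z : Ω → C) :
    MI μ (fun ω => (Z ω, Y ω)) X = MI μ Z X + condMI μ X Y Z := by
  rw [MI_eq_expectation, MI_eq_expectation, condMI_eq_expectation, ← Finset.sum_add_distrib]
  refine Finset.sum_congr rfl fun ω _ => ?_
  rw [valueProb_congr μ (fun ω => ((Z ω, Y ω), X ω)) (fun ω => (X ω, Y ω, Z ω))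
      (fun ω ω' => by simp only [Prod.mk.injEq]; tauto),
    valueProb_congr μ (fun ω => (Z ω, Y ω)) (fun ω => (Y ω, Z ω))
      (fun ω ω' => by simp only [Prod.mk.injEq]; tauto),
    valueProb_congr μ (fun ω => (Z ω, X ω)) (fun ω => (X ω, Z ω))
      (fun ω ω' => by simp only [Prod.mk.injEq]; tauto)]
  ring

lemma jointRV_eq_iff {Ω V α : Type*} [DecidableEq V] (X : V → Ω → α) (s : Finset V)
    (ω ω' : Ω) : jointRV X s ω = jointRV X s ω' ↔ ∀ v ∈ s, X v ω = X v ω' := by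
  refine ⟨fun h v hv => ?_, fun h => funext fun v => ?_⟩
  · simpa [jointRV, hv] using congrFun h v
  · by_cases hv : v ∈ s
    · simp [jointRV, hv, h v hv]
    · simp [jointRV, hv]

/-- Synergy equals redundancy plus the increase of the mutual information between the
target and one source caused by conditioning on the other source. -/
lemma BivPID.syn_eq_red_add {Ω V α : Type*} [Fintype Ω] [Fintype V] [DecidableEq V]
    [Fintype α] [DecidableEq α] {μ : FinProb Ω} {X : V → Ω → α} (P : BivPID μ X) (j k i : V) :
    P.Syn {j} {k} i =
      P.Red {j} {k} i + (condMI μ (X i) (X k) (X j) - MI μ (X i) (X k)) := by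
  have hj : MI μ (jointRV X {j}) (X i) = MI μ (X j) (X i) :=
    MI_congr_left μ _ _ _ fun ω ω' => by simp [jointRV_eq_iff]
  have hk : MI μ (jointRV X {k}) (X i) = MI μ (X i) (X k) :=
    (MI_congr_left μ _ (X k) _ fun ω ω' => by simp [jointRV_eq_iff]).trans (MI_comm μ _ _)
  have hjk : MI μ (jointRV X ({j} ∪ {k})) (X i) = MI μ (fun ω => (X j ω, X k ω)) (X i) :=
    MI_congr_left μ _ _ _ fun ω ω' => by simp [jointRV_eq_iff]
  linarith [P.consistency_fst {j} {k} i, P.consistency_snd {j} {k} i,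
    P.consistency_joint {j} {k} i, MI_chain_rule μ (X i) (X k) (X j)]

/-- PID signatures of a directed hyperedge in a faithful Bayesian
hypergraph with collider amplification: (i) any head variable has positive pairwise
synergy with any co-tail about each tail variable; (ii) each head variable has
positive unique information about each tail variable; (iii) distinct co-heads have
positive unique information about each other. -/
theorem hyperedge_pid_signatures
    {Ω V α : Type*} [Fintype Ω] [Fintype V] [DecidableEq V] [Fintype α] [DecidableEq α]
    (μ : FinProb Ω) (X : V → Ω → α) (E : Finset (Finset V × Finset V))
    (hdisj : ∀ ε ∈ E, Disjoint ε.1 ε.2)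
    (hacyc : HAcyclic E)
    (hfact : HFactorizes μ X E)
    (hfaith : HFaithful μ X E)
    (hca : HColliderAmp μ X E)
    (P : BivPID μ X) (hpr : P.PersistentRelevance)
    (ε : Finset V × Finset V) (hε : ε ∈ E) :
    (∀ i ∈ ε.1, ∀ j ∈ ε.2, ∀ k ∈ ε.1, k ≠ i → 0 < P.Syn {j} {k} i) ∧
    (∀ i ∈ ε.1, ∀ j ∈ ε.2, 0 < P.uniqC j i) ∧
    (∀ j ∈ ε.2, ∀ k ∈ ε.2, j ≠ k → 0 < P.uniqC j k ∧ 0 < P.uniqC k j) := by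
  have huniq : ∀ j i : V, j ≠ i →
      (IsHParent E j i ∨ IsHChild E j i ∨ IsHCoHead E j i) → 0 < P.uniqC j i :=
    fun j i hne hadj => hpr j i hne fun C hC =>
      hfaith.1 i j hne hadj C (by rwa [Finset.pair_comm])
  refine ⟨fun i hi j hj k hk hki => ?_, fun i hi j hj => ?_, fun j hj k hk hjk => ⟨?_, ?_⟩⟩
  · linarith [P.syn_eq_red_add j k i, P.red_nonneg {j} {k} i, hca ε hε i hi k hk hki.symm j hj]
  · exact huniq j i (Finset.disjoint_left.mp (hdisj ε hε) hi <| · ▸ hj)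
      (Or.inr (Or.inl ⟨ε, hε, hj, hi⟩))
  · exact huniq j k hjk (Or.inr (Or.inr ⟨hjk, ε, hε, hj, hk⟩))
  · exact huniq k j hjk.symm (Or.inr (Or.inr ⟨hjk.symm, ε, hε, hk, hj⟩))
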